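/- arXiv:2012.01383 — 5 statements merged into one kernel-verified Lean document; each statement's English description precedes it below -/
import Mathlib

section
/- Normal form for holomorphic discs (analytic core of the disc-normalization lemma): Let r > 0, a ∈ ℂ, and let ψ, φ : ℂ → ℂ be analytic on the open ball B(0,r) with ψ(0) ≠ 0. Then there exist ρ > 0, an analytic function g on B(0,ρ), and analytic functions F and q on B(a,ρ²) such that: (i) g is odd, i.e. g(−z) = −g(z) for all z ∈ B(0,ρ), and (g′(0))³ = ψ(0) (in particular g′(0) ≠ 0); (ii) the derivative of z ↦ g(z)³ equals 3·z²·ψ(z²) at every z ∈ B(0,ρ); (iii) F(a) = 0, F′(a) ≠ 0, and F(z² + a) = g(z)² for all z ∈ B(0,ρ); (iv) F′(z² + a)·(g(z) − q(z² + a)) = z·ψ(z²) + φ(z²) for all z ∈ B(0,ρ). -/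
open Metric

/-- The singular equation `H + (2/3) t H' = ψ` has a holomorphic solution on any disc around `0`
on which `ψ` is holomorphic, namely `H t = ∫₀¹ 3 s² ψ(s² t) ds`. -/
lemma exists_hasDerivAt_add_mul_eq {r : ℝ} {ψ : ℂ → ℂ} (hψ : AnalyticOnNhd ℂ ψ (ball 0 r)) :
    ∃ H H' : ℂ → ℂ, ∀ t ∈ ball (0 : ℂ) r,
      HasDerivAt H (H' t) t ∧ H t + 2 / 3 * t * H' t = ψ t := by
  have hscale : ∀ {R : ℝ} {t : ℂ} {s : ℝ}, s ∈ Set.Icc (0 : ℝ) 1 → ‖t‖ < R →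
      ‖(s : ℂ) ^ 2 * t‖ < R := by
    intro R t s hs ht
    have h1 : ‖(s : ℂ) ^ 2‖ ≤ 1 := by
      rw [norm_pow, Complex.norm_real, Real.norm_of_nonneg hs.1]
      exact pow_le_one₀ hs.1 hs.2
    rw [norm_mul]
    nlinarith [norm_nonneg t]
  have hmaps : ∀ {t : ℂ}, t ∈ ball (0 : ℂ) r →
      Set.MapsTo (fun s : ℝ => (s : ℂ) ^ 2 * t) (Set.Icc 0 1) (ball 0 r) := by
    intro t ht s hs
    exact mem_ball_zero_iff.2 (hscale hs (mem_ball_zero_iff.1 ht))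
  have hcont : ∀ {t : ℂ}, t ∈ ball (0 : ℂ) r →
      ContinuousOn (fun s : ℝ => 3 * (s : ℂ) ^ 2 * ψ ((s : ℂ) ^ 2 * t)) (Set.Icc 0 1) := by
    intro t ht
    exact (by fun_prop : Continuous fun s : ℝ => 3 * (s : ℂ) ^ 2).continuousOn.mul
      (hψ.continuousOn.comp (by fun_prop) (hmaps ht))
  have hcont' : ∀ {t : ℂ}, t ∈ ball (0 : ℂ) r →
      ContinuousOn (fun s : ℝ => 3 * (s : ℂ) ^ 4 * deriv ψ ((s : ℂ) ^ 2 * t)) (Set.Icc 0 1) := by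
    intro t ht
    exact (by fun_prop : Continuous fun s : ℝ => 3 * (s : ℂ) ^ 4).continuousOn.mul
      (hψ.deriv.continuousOn.comp (by fun_prop) (hmaps ht))
  have hIoc : Set.uIoc (0 : ℝ) 1 ⊆ Set.Icc 0 1 := by
    rw [Set.uIoc_of_le zero_le_one]; exact Set.Ioc_subset_Icc_self
  refine ⟨fun t => ∫ s in (0 : ℝ)..1, 3 * (s : ℂ) ^ 2 * ψ ((s : ℂ) ^ 2 * t),
    fun t => ∫ s in (0 : ℝ)..1, 3 * (s : ℂ) ^ 4 * deriv ψ ((s : ℂ) ^ 2 * t), fun t ht => ?_⟩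
  have hint := (hcont ht).intervalIntegrable_of_Icc zero_le_one (μ := MeasureTheory.volume)
  have hint' := (hcont' ht).intervalIntegrable_of_Icc zero_le_one (μ := MeasureTheory.volume)
  constructor
  · obtain ⟨R, htR, hRr⟩ := exists_between (mem_ball_zero_iff.1 ht)
    obtain ⟨C, hC⟩ := (isCompact_closedBall (0 : ℂ) R).exists_bound_of_continuousOn
      (hψ.deriv.continuousOn.mono (closedBall_subset_ball hRr))
    refine (intervalIntegral.hasDerivAt_integral_of_dominated_loc_of_deriv_le
      (F := fun t (s : ℝ) => 3 * (s : ℂ) ^ 2 * ψ ((s : ℂ) ^ 2 * t))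
      (F' := fun t (s : ℝ) => 3 * (s : ℂ) ^ 4 * deriv ψ ((s : ℂ) ^ 2 * t))
      (s := ball 0 R) (bound := fun _ => 3 * C)
      (isOpen_ball.mem_nhds (mem_ball_zero_iff.2 htR)) ?_ hint ?_ ?_
      intervalIntegrable_const ?_).2
    · filter_upwards [isOpen_ball.mem_nhds ht] with x hx
      exact ((hcont hx).mono hIoc).aestronglyMeasurable measurableSet_uIoc
    · exact ((hcont' ht).mono hIoc).aestronglyMeasurable measurableSet_uIoc
    · refine Filter.Eventually.of_forall fun s hs x hx => ?_
      have hs := hIoc hs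
      have h1 := hC _ (mem_closedBall_zero_iff.2 (hscale hs (mem_ball_zero_iff.1 hx)).le)
      have h2 : ‖(s : ℂ) ^ 4‖ ≤ 1 := by
        rw [norm_pow, Complex.norm_real, Real.norm_of_nonneg hs.1]
        exact pow_le_one₀ hs.1 hs.2
      have h3 : ‖(3 : ℂ)‖ = 3 := by simp
      rw [norm_mul, norm_mul, h3]
      nlinarith [norm_nonneg ((s : ℂ) ^ 4), norm_nonneg (deriv ψ ((s : ℂ) ^ 2 * x))]
    · refine Filter.Eventually.of_forall fun s hs x hx => ?_
      have hx : x ∈ ball (0 : ℂ) r := ball_subset_ball hRr.le hx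
      have h1 := (hψ _ (hmaps hx (hIoc hs))).differentiableAt.hasDerivAt
      have h2 := (h1.comp x ((hasDerivAt_id x).const_mul ((s : ℂ) ^ 2))).const_mul
        (3 * (s : ℂ) ^ 2)
      convert! h2 using 1
      ring
  · have hderiv : ∀ s ∈ Set.uIcc (0 : ℝ) 1,
        HasDerivAt (fun s : ℝ => (s : ℂ) ^ 3 * ψ ((s : ℂ) ^ 2 * t))
          (3 * (s : ℂ) ^ 2 * ψ ((s : ℂ) ^ 2 * t) +
            2 / 3 * t * (3 * (s : ℂ) ^ 4 * deriv ψ ((s : ℂ) ^ 2 * t))) s := by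
      intro s hs
      rw [Set.uIcc_of_le zero_le_one] at hs
      have h1 := (hψ _ (hmaps ht hs)).differentiableAt.hasDerivAt
      have h2 := ((hasDerivAt_id (s : ℂ)).pow 3).mul
        (h1.comp (s : ℂ) (((hasDerivAt_id (s : ℂ)).pow 2).mul_const t))
      convert! h2.comp_ofReal using 1
      simp
      ring
    have hFTC := intervalIntegral.integral_eq_sub_of_hasDerivAt hderiv
      (hint.add (hint'.const_mul _))
    rw [intervalIntegral.integral_add hint (hint'.const_mul _),
      intervalIntegral.integral_const_mul] at hFTC
    simpa using hFTC

/-- Near `0`, the solution of `H + (2/3) t H' = ψ` with `ψ 0 ≠ 0` is the cube of an analytic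
function `h`, which then satisfies `h³ + 2 t h² h' = ψ`. -/
lemma exists_analytic_cube_root {r : ℝ} (hr : 0 < r) {ψ : ℂ → ℂ}
    (hψ : AnalyticOnNhd ℂ ψ (ball 0 r)) (hψ0 : ψ 0 ≠ 0) :
    ∃ δ > 0, δ ≤ r ∧ ∃ h : ℂ → ℂ, AnalyticOnNhd ℂ h (ball 0 δ) ∧ ∀ t ∈ ball (0 : ℂ) δ,
      ψ t ≠ 0 ∧ h t ^ 3 + 2 * t * h t ^ 2 * deriv h t = ψ t := by
  obtain ⟨H, H', hH⟩ := exists_hasDerivAt_add_mul_eq hψ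
  have h0 : (0 : ℂ) ∈ ball (0 : ℂ) r := mem_ball_self hr
  have hH0 : H 0 = ψ 0 := by simpa using (hH 0 h0).2
  have hslit : ∀ᶠ t in nhds (0 : ℂ), H t / ψ 0 ∈ Complex.slitPlane := by
    refine ((hH 0 h0).1.continuousAt.div_const (ψ 0)).eventually_mem
      (Complex.isOpen_slitPlane.mem_nhds ?_)
    simp [hH0, hψ0]
  obtain ⟨ε, hε, hball⟩ := Metric.eventually_nhds_iff_ball.1
    (hslit.and ((hψ 0 h0).continuousAt.eventually_ne hψ0))
  obtain ⟨c, hc⟩ := IsAlgClosed.exists_pow_nat_eq (ψ 0) (n := 3) (by norm_num)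
  have hcube : ∀ t ∈ ball (0 : ℂ) ε,
      (c * Complex.exp (Complex.log (H t / ψ 0) / 3)) ^ 3 = H t := by
    intro t ht
    rw [mul_pow, hc, ← Complex.exp_nat_mul]
    push_cast
    rw [mul_div_cancel₀ _ (by norm_num : (3 : ℂ) ≠ 0),
      Complex.exp_log (Complex.slitPlane_ne_zero (hball t ht).1), mul_div_cancel₀ _ hψ0]
  have hdiff : DifferentiableOn ℂ (fun t => c * Complex.exp (Complex.log (H t / ψ 0) / 3))
      (ball 0 (min ε r)) := by
    intro t ht
    have hd := (hH t (ball_subset_ball (min_le_right _ _) ht)).1.differentiableAt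
    exact ((((hd.div_const _).clog (hball t (ball_subset_ball (min_le_left _ _) ht)).1).div_const
      3).cexp.const_mul c).differentiableWithinAt
  refine ⟨min ε r, lt_min hε hr, min_le_right _ _, _, hdiff.analyticOnNhd isOpen_ball, ?_⟩
  intro t ht
  have htε := ball_subset_ball (min_le_left _ _) ht
  obtain ⟨hHt, hode⟩ := hH t (ball_subset_ball (min_le_right _ _) ht)
  refine ⟨(hball t htε).2, ?_⟩
  have hpow := (hdiff.differentiableAt (isOpen_ball.mem_nhds ht)).hasDerivAt.pow 3
  have huniq := (hpow.congr_of_eventuallyEq (f₁ := H) (by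
    filter_upwards [isOpen_ball.mem_nhds htε] with x hx using (hcube x hx).symm)).unique hHt
  rw [hcube t htε, ← hode, ← huniq]
  push_cast
  ring

theorem disc_normal_form
    (r : ℝ) (hr : 0 < r) (a : ℂ) (ψ φ : ℂ → ℂ)
    (hψ : AnalyticOnNhd ℂ ψ (ball (0 : ℂ) r))
    (hφ : AnalyticOnNhd ℂ φ (ball (0 : ℂ) r))
    (hψ0 : ψ 0 ≠ 0) :
    ∃ (ρ : ℝ) (g F q : ℂ → ℂ), 0 < ρ ∧
      AnalyticOnNhd ℂ g (ball (0 : ℂ) ρ) ∧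
      AnalyticOnNhd ℂ F (ball a (ρ ^ 2)) ∧
      AnalyticOnNhd ℂ q (ball a (ρ ^ 2)) ∧
      (∀ z ∈ ball (0 : ℂ) ρ, g (-z) = - g z) ∧
      (deriv g 0) ^ 3 = ψ 0 ∧
      (∀ z ∈ ball (0 : ℂ) ρ, deriv (fun w : ℂ => g w ^ 3) z = 3 * z ^ 2 * ψ (z ^ 2)) ∧
      F a = 0 ∧ deriv F a ≠ 0 ∧
      (∀ z ∈ ball (0 : ℂ) ρ, F (z ^ 2 + a) = g z ^ 2) ∧
      (∀ z ∈ ball (0 : ℂ) ρ,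
        deriv F (z ^ 2 + a) * (g z - q (z ^ 2 + a)) = z * ψ (z ^ 2) + φ (z ^ 2)) := by
  obtain ⟨δ, hδ, hδr, h, hh, hode⟩ := exists_analytic_cube_root hr hψ hψ0
  have hsq : Real.sqrt δ ^ 2 = δ := Real.sq_sqrt hδ.le
  have h0 : (0 : ℂ) ∈ ball (0 : ℂ) δ := mem_ball_self hδ
  have hmem : ∀ {z : ℂ}, z ∈ ball (0 : ℂ) (Real.sqrt δ) → z ^ 2 ∈ ball (0 : ℂ) δ := by
    intro z hz
    rw [mem_ball_zero_iff] at hz ⊢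
    rw [norm_pow, ← hsq]
    exact pow_lt_pow_left₀ hz (norm_nonneg z) two_ne_zero
  have hsub : ∀ {x : ℂ}, x ∈ ball a δ → x - a ∈ ball (0 : ℂ) δ := by
    intro x hx
    rwa [mem_ball_zero_iff, ← mem_ball_iff_norm]
  have hh' : ∀ {t : ℂ}, t ∈ ball (0 : ℂ) δ → HasDerivAt h (deriv h t) t := fun ht =>
    (hh _ ht).differentiableAt.hasDerivAt
  have hg : ∀ z ∈ ball (0 : ℂ) (Real.sqrt δ), HasDerivAt (fun z => z * h (z ^ 2))
      (h (z ^ 2) + 2 * z ^ 2 * deriv h (z ^ 2)) z := by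
    intro z hz
    convert! (hasDerivAt_id z).mul ((hh' (hmem hz)).comp z ((hasDerivAt_id z).pow 2)) using 1
    simp
    ring
  have hF : ∀ x ∈ ball a δ, HasDerivAt (fun x => (x - a) * h (x - a) ^ 2)
      (h (x - a) ^ 2 + 2 * (x - a) * h (x - a) * deriv h (x - a)) x := by
    intro x hx
    have hs := (hasDerivAt_id x).sub_const a
    convert! hs.mul (((hh' (hsub hx)).comp x hs).pow 2) using 1
    simp
    ring
  have hFh : ∀ x ∈ ball a δ,
      deriv (fun x => (x - a) * h (x - a) ^ 2) x * h (x - a) = ψ (x - a) := by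
    intro x hx
    rw [(hF x hx).deriv, ← (hode _ (hsub hx)).2]
    ring
  have hF0 : ∀ x ∈ ball a δ, deriv (fun x => (x - a) * h (x - a) ^ 2) x ≠ 0 := by
    intro x hx hzero
    have := hFh x hx
    rw [hzero, zero_mul] at this
    exact (hode _ (hsub hx)).1 this.symm
  have hFan : AnalyticOnNhd ℂ (fun x => (x - a) * h (x - a) ^ 2) (ball a δ) :=
    DifferentiableOn.analyticOnNhd
      (fun x hx => (hF x hx).differentiableAt.differentiableWithinAt) isOpen_ball
  refine ⟨Real.sqrt δ, fun z => z * h (z ^ 2), fun x => (x - a) * h (x - a) ^ 2,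
    fun x => -φ (x - a) / deriv (fun x => (x - a) * h (x - a) ^ 2) x,
    Real.sqrt_pos.2 hδ, ?_, ?_, ?_, ?_, ?_, ?_, ?_, ?_, ?_, ?_⟩
  · exact DifferentiableOn.analyticOnNhd
      (fun z hz => (hg z hz).differentiableAt.differentiableWithinAt) isOpen_ball
  · rwa [hsq]
  · rw [hsq]
    refine AnalyticOnNhd.div (AnalyticOnNhd.neg ?_) hFan.deriv hF0
    exact (hφ.mono (ball_subset_ball hδr)).comp (analyticOnNhd_id.sub analyticOnNhd_const)
      fun x hx => hsub hx
  · intro z _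
    simp
  · rw [(hg 0 (mem_ball_self (Real.sqrt_pos.2 hδ))).deriv]
    simpa using (hode 0 h0).2
  · intro z hz
    rw [((hg z hz).fun_pow 3).deriv, ← (hode _ (hmem hz)).2]
    push_cast
    ring
  · simp
  · exact hF0 a (mem_ball_self hδ)
  · intro z _
    simp only [add_sub_cancel_right]
    ring
  · intro z hz
    have hx : z ^ 2 + a ∈ ball a δ := by
      simpa [mem_ball_iff_norm] using hmem hz
    have h1 := hFh _ hx
    have h2 := mul_div_cancel₀ (-φ (z ^ 2)) (hF0 _ hx)
    simp only [add_sub_cancel_right] at h1 ⊢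
    linear_combination z * h1 - h2
end

section
/- ℤ₃-uniqueness of the disc normal form: Let r, ρ > 0 and let ψ : ℂ → ℂ be analytic on B(0,r) with ψ(0) ≠ 0. Suppose g₁ and g₂ are analytic on the open ball B(0,ρ), satisfy g₁(0) = g₂(0) = 0, and for every z ∈ B(0,ρ) the derivative of z ↦ g₁(z)³ and the derivative of z ↦ g₂(z)³ both equal 3·z²·ψ(z²). Then there exists ξ ∈ ℂ with ξ³ = 1 such that g₁(z) = ξ·g₂(z) for all z ∈ B(0,ρ). -/
open Metric

/-- If a finite product of analytic functions vanishes on a nonempty preconnected set, then so does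
one of the factors. -/
theorem AnalyticOnNhd.exists_eq_zero_of_prod_eq_zero {ι : Type*} {U : Set ℂ}
    (hU : IsPreconnected U) (hne : U.Nonempty) (s : Finset ι) {f : ι → ℂ → ℂ}
    (hf : ∀ i ∈ s, AnalyticOnNhd ℂ (f i) U) (h : ∀ z ∈ U, ∏ i ∈ s, f i z = 0) :
    ∃ i ∈ s, ∀ z ∈ U, f i z = 0 := by
  classical
  induction s using Finset.induction_on with
  | empty =>
    obtain ⟨z, hz⟩ := hne
    simpa using h z hz
  | insert a s ha ih =>
    have hs : ∀ i ∈ s, AnalyticOnNhd ℂ (f i) U := fun i hi => hf i (Finset.mem_insert_of_mem hi)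
    have hprod : AnalyticOnNhd ℂ (fun z => ∏ i ∈ s, f i z) U :=
      Finset.analyticOnNhd_fun_prod s hs
    rcases (hf a (Finset.mem_insert_self a s)).eq_zero_or_eq_zero_of_mul_eq_zero hprod
      (fun z hz => by simpa [Finset.prod_insert ha] using h z hz) hU with h₀ | h₀
    · exact ⟨a, Finset.mem_insert_self a s, h₀⟩
    · obtain ⟨i, hi, hi₀⟩ := ih hs h₀
      exact ⟨i, Finset.mem_insert_of_mem hi, hi₀⟩

/-- Two analytic functions with the same `n`-th power on a nonempty preconnected set differ by a
constant `n`-th root of unity. -/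
theorem AnalyticOnNhd.exists_eq_mul_of_pow_eq {U : Set ℂ} (hU : IsPreconnected U)
    (hne : U.Nonempty) {n : ℕ} (hn : n ≠ 0) {f g : ℂ → ℂ} (hf : AnalyticOnNhd ℂ f U)
    (hg : AnalyticOnNhd ℂ g U) (h : ∀ z ∈ U, f z ^ n = g z ^ n) :
    ∃ ξ : ℂ, ξ ^ n = 1 ∧ ∀ z ∈ U, f z = ξ * g z := by
  have hpos : 0 < n := Nat.pos_of_ne_zero hn
  obtain ⟨ξ, hξ, hfg⟩ := exists_eq_zero_of_prod_eq_zero hU hne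
    (Polynomial.nthRootsFinset n (1 : ℂ)) (f := fun ξ z => f z - ξ * g z)
    (fun ξ _ => hf.sub (analyticOnNhd_const.mul hg)) (fun z hz => by
      rw [← (Complex.isPrimitiveRoot_exp n hn).pow_sub_pow_eq_prod_sub_mul _ _ hpos, h z hz,
        sub_self])
  exact ⟨ξ, (Polynomial.mem_nthRootsFinset hpos 1).1 hξ, fun z hz => sub_eq_zero.1 (hfg z hz)⟩

/-- **ℤ₃-uniqueness of the disc normal form.**  If `g₁, g₂` are analytic on `B(0,ρ)`,
vanish at `0`, and both satisfy `(gᵢ³)'(z) = 3 z² ψ(z²)` on `B(0,ρ)` (for `ψ` analytic on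
`B(0,r)` with `ψ 0 ≠ 0`), then `g₁ = ξ · g₂` on `B(0,ρ)` for some cube root of unity `ξ`. -/
theorem disc_normal_form_unique_up_to_cube_root
    (r ρ : ℝ) (hr : 0 < r) (hρ : 0 < ρ) (ψ g₁ g₂ : ℂ → ℂ)
    (hψ : AnalyticOnNhd ℂ ψ (ball (0 : ℂ) r)) (hψ0 : ψ 0 ≠ 0)
    (hg₁ : AnalyticOnNhd ℂ g₁ (ball (0 : ℂ) ρ))
    (hg₂ : AnalyticOnNhd ℂ g₂ (ball (0 : ℂ) ρ))
    (hg₁0 : g₁ 0 = 0) (hg₂0 : g₂ 0 = 0)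
    (hd₁ : ∀ z ∈ ball (0 : ℂ) ρ, deriv (fun w : ℂ => g₁ w ^ 3) z = 3 * z ^ 2 * ψ (z ^ 2))
    (hd₂ : ∀ z ∈ ball (0 : ℂ) ρ, deriv (fun w : ℂ => g₂ w ^ 3) z = 3 * z ^ 2 * ψ (z ^ 2)) :
    ∃ ξ : ℂ, ξ ^ 3 = 1 ∧ ∀ z ∈ ball (0 : ℂ) ρ, g₁ z = ξ * g₂ z := by
  have hU : IsPreconnected (ball (0 : ℂ) ρ) := (convex_ball 0 ρ).isPreconnected
  have h0 : (0 : ℂ) ∈ ball (0 : ℂ) ρ := mem_ball_self hρ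
  refine AnalyticOnNhd.exists_eq_mul_of_pow_eq hU ⟨0, h0⟩ three_ne_zero hg₁ hg₂ fun z hz => ?_
  exact isOpen_ball.eqOn_of_deriv_eq hU (hg₁.differentiableOn.fun_pow 3)
    (hg₂.differentiableOn.fun_pow 3) (fun w hw => (hd₁ w hw).trans (hd₂ w hw).symm) h0
    (by simp only [hg₁0, hg₂0]) hz
end

section
/- Double dual of a discrete vector space: Let K be a field and V a vector space over K. Equip K with the discrete topology and equip the algebraic dual V* = Hom_K(V, K) with the topology of pointwise convergence, i.e. the initial topology induced by the evaluation maps V* → K, f ↦ f(v), for v ∈ V. Then the canonical map from V to the space of continuous K-linear functionals on V*, sending v to the functional f ↦ f(v), is bijective. Equivalently, a K-linear functional φ : V* → K is continuous if and only if there exists a (necessarily unique) v ∈ V with φ(f) = f(v) for all f ∈ V*. -/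
/-- The topology of pointwise convergence on the algebraic dual `V* = Hom_K(V, K)`,
i.e. the initial topology induced by the evaluation maps `f ↦ f v`, where `K` carries the
discrete topology. -/
def dualPointwiseTopology (K V : Type*) [Field K] [AddCommGroup V] [Module K V] :
    TopologicalSpace (Module.Dual K V) :=
  TopologicalSpace.induced (fun f : Module.Dual K V => (⇑f : V → K))
    (@Pi.topologicalSpace V (fun _ => K) (fun _ => ⊥))

/-- A linear functional on the dual that is continuous for pointwise convergence vanishes on the
common kernel of finitely many evaluations. -/
theorem exists_finset_forall_eq_zero_of_continuous_dualPointwise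
    {K V : Type*} [Field K] [AddCommGroup V] [Module K V] {φ : Module.Dual K V →ₗ[K] K}
    (hφ : @Continuous (Module.Dual K V) K (dualPointwiseTopology K V) ⊥ ⇑φ) :
    ∃ s : Finset V, ∀ f : Module.Dual K V, (∀ v ∈ s, f v = 0) → φ f = 0 := by
  let _ : TopologicalSpace K := ⊥
  have _ : DiscreteTopology K := ⟨rfl⟩
  let _ : TopologicalSpace (Module.Dual K V) := dualPointwiseTopology K V
  obtain ⟨U, hU, hUφ⟩ := isOpen_induced_iff.1 ((isOpen_discrete ({0} : Set K)).preimage hφ)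
  have mem_iff (f : Module.Dual K V) : (⇑f : V → K) ∈ U ↔ φ f = 0 :=
    Set.ext_iff.1 hUφ f
  obtain ⟨s, u, hu, hsU⟩ := isOpen_pi_iff.1 hU _ ((mem_iff 0).2 (map_zero φ))
  refine ⟨s, fun f hf => (mem_iff f).1 (hsU fun v hv => ?_)⟩
  simpa [hf v hv] using (hu v hv).2

/-- **Double dual of a discrete vector space.**  With `K` discrete and the algebraic dual
`V*` carrying the topology of pointwise convergence, a `K`-linear functional
`φ : V* → K` is continuous if and only if there is a (necessarily unique) `v ∈ V` with
`φ f = f v` for all `f`; i.e. the canonical map `V → (V*)*_{cont}` is bijective. -/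
theorem double_dual_of_discrete_vector_space
    (K : Type*) [Field K] (V : Type*) [AddCommGroup V] [Module K V]
    (φ : Module.Dual K V →ₗ[K] K) :
    @Continuous (Module.Dual K V) K (dualPointwiseTopology K V) ⊥ ⇑φ ↔
      ∃! v : V, ∀ f : Module.Dual K V, φ f = f v := by
  constructor
  · intro hφ
    obtain ⟨s, hs⟩ := exists_finset_forall_eq_zero_of_continuous_dualPointwise hφ
    have hspan : φ ∈ Submodule.span K (Set.range fun v : s => Module.Dual.eval K V v) := by
      refine mem_span_of_iInf_ker_le_ker fun f hf => hs f fun v hv => ?_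
      simpa using (Submodule.mem_iInf _).1 hf ⟨v, hv⟩
    have hle : Submodule.span K (Set.range fun v : s => Module.Dual.eval K V v) ≤
        LinearMap.range (Module.Dual.eval K V) :=
      Submodule.span_le.2 (Set.range_subset_iff.2 fun v => LinearMap.mem_range_self _ _)
    obtain ⟨v, rfl⟩ := hle hspan
    exact ⟨v, fun _ => rfl, fun w hw => Module.eval_apply_injective K
      (LinearMap.ext fun f => (hw f).symm)⟩
  · rintro ⟨v, hv, -⟩
    let _ : TopologicalSpace K := ⊥
    let _ : TopologicalSpace (Module.Dual K V) := dualPointwiseTopology K V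
    rw [show ⇑φ = (fun g : V → K => g v) ∘ fun f : Module.Dual K V => (⇑f : V → K) from funext hv]
    exact (continuous_apply v).comp continuous_induced_dom
end

section
/- The Tate space W = V ⊕ V* is a symplectic topological vector space: Let K be a field and V a K-vector space with algebraic dual V* = Hom_K(V, K). Equip W := V × V* with the product of the discrete topology on V and the topology of pointwise convergence on V* (K carrying the discrete topology), and define Ω : W × W → K by Ω((v,f),(v′,f′)) := f′(v) − f(v′). Then Ω is an alternating bilinear form, and the map from W to the space of continuous K-linear functionals on W, sending w to the functional Ω(w,·), is bijective. -/
/-- The product of the discrete topology on `V` and the topology of pointwise convergence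
on `V*`: the topology of the Tate space `W = V ⊕ V*`. -/
def tateTopology (K V : Type*) [Field K] [AddCommGroup V] [Module K V] :
    TopologicalSpace (V × Module.Dual K V) :=
  @instTopologicalSpaceProd V (Module.Dual K V) ⊥ (dualPointwiseTopology K V)

/-- Evaluation at a fixed vector is continuous for the topology of pointwise convergence. -/
theorem continuous_dual_eval (K V : Type*) [Field K] [AddCommGroup V] [Module K V] (v : V) :
    @Continuous (Module.Dual K V) K (dualPointwiseTopology K V) ⊥ (fun f => f v) := by
  let : TopologicalSpace K := ⊥
  let : TopologicalSpace (Module.Dual K V) := dualPointwiseTopology K V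
  exact (continuous_apply v).comp continuous_induced_dom

/-- A linear functional on `V*` that is continuous for the topology of pointwise convergence is
evaluation at some vector. -/
theorem exists_eq_dual_eval_of_continuous {K V : Type*} [Field K] [AddCommGroup V] [Module K V]
    (ψ : Module.Dual K V →ₗ[K] K)
    (hψ : @Continuous (Module.Dual K V) K (dualPointwiseTopology K V) ⊥ ψ) :
    ∃ v : V, Module.Dual.eval K V v = ψ := by
  let : TopologicalSpace K := ⊥
  have : DiscreteTopology K := ⟨rfl⟩
  let : TopologicalSpace (Module.Dual K V) := dualPointwiseTopology K V
  obtain ⟨U, hU, hUψ⟩ := isOpen_induced_iff.1 ((isOpen_discrete ({0} : Set K)).preimage hψ)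
  have h_zero : ⇑(0 : Module.Dual K V) ∈ U := by
    change (0 : Module.Dual K V) ∈ (fun f : Module.Dual K V => (⇑f : V → K)) ⁻¹' U
    rw [hUψ]
    simp
  obtain ⟨s, u, hu, hsU⟩ := isOpen_pi_iff.1 hU _ h_zero
  have h_mem : ψ ∈ Submodule.span K (Set.range fun v : s => Module.Dual.eval K V v) := by
    refine mem_span_of_iInf_ker_le_ker fun f hf => ?_
    simp only [Submodule.mem_iInf, LinearMap.mem_ker, Module.Dual.eval_apply] at hf
    have hfU : f ∈ (fun f : Module.Dual K V => (⇑f : V → K)) ⁻¹' U := by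
      refine hsU fun v hv => ?_
      change f v ∈ u v
      rw [hf ⟨v, hv⟩]
      exact (hu v hv).2
    rw [hUψ] at hfU
    exact hfU
  have h_le : Submodule.span K (Set.range fun v : s => Module.Dual.eval K V v) ≤
      LinearMap.range (Module.Dual.eval K V) :=
    Submodule.span_le.2 (Set.range_subset_iff.2 fun v => ⟨v, rfl⟩)
  exact h_le h_mem

/-- **The Tate space `W = V ⊕ V*` is a symplectic topological vector space.**
With `Ω ((v,f),(v',f')) = f' v − f v'`:  `Ω` is alternating and bilinear, each `Ω w ·` is a
continuous linear functional, and every continuous linear functional on `W` equals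
`Ω w ·` for a unique `w`; i.e. `w ↦ Ω w ·` is a bijection onto the continuous dual. -/
theorem tate_space_is_symplectic
    (K : Type*) [Field K] (V : Type*) [AddCommGroup V] [Module K V]
    (Ω : (V × Module.Dual K V) → (V × Module.Dual K V) → K)
    (hΩ : ∀ w w', Ω w w' = w'.2 w.1 - w.2 w'.1) :
    (∀ w, Ω w w = 0) ∧
    (∀ w, IsLinearMap K (Ω w)) ∧
    (∀ w', IsLinearMap K (fun w => Ω w w')) ∧
    (∀ w, ∃ φ : (V × Module.Dual K V) →ₗ[K] K,
        ⇑φ = Ω w ∧ @Continuous (V × Module.Dual K V) K (tateTopology K V) ⊥ ⇑φ) ∧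
    (∀ φ : (V × Module.Dual K V) →ₗ[K] K,
        @Continuous (V × Module.Dual K V) K (tateTopology K V) ⊥ ⇑φ →
          ∃! w, ⇑φ = Ω w) := by
  have h_lin : ∀ w, IsLinearMap K (Ω w) := fun w =>
    ⟨fun x y => by simp only [hΩ, Prod.fst_add, Prod.snd_add, LinearMap.add_apply, map_add]; ring,
      fun c x => by
        simp only [hΩ, Prod.smul_fst, Prod.smul_snd, LinearMap.smul_apply, map_smul, smul_eq_mul]
        ring⟩
  let : TopologicalSpace K := ⊥
  let : TopologicalSpace V := ⊥
  let : TopologicalSpace (Module.Dual K V) := dualPointwiseTopology K V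
  have : DiscreteTopology K := ⟨rfl⟩
  have : DiscreteTopology V := ⟨rfl⟩
  refine ⟨fun w => by rw [hΩ, sub_self], h_lin, fun w' => ⟨fun x y => ?_, fun c x => ?_⟩,
    fun w => ⟨(h_lin w).mk' _, rfl, ?_⟩, fun φ hφ => ?_⟩
  · simp only [hΩ, Prod.fst_add, Prod.snd_add, LinearMap.add_apply, map_add]
    ring
  · simp only [hΩ, Prod.smul_fst, Prod.smul_snd, LinearMap.smul_apply, map_smul, smul_eq_mul]
    ring
  · have h_eval : Continuous fun w' : V × Module.Dual K V => w'.2 w.1 :=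
      (continuous_dual_eval K V w.1).comp continuous_snd
    have h_fst : Continuous fun w' : V × Module.Dual K V => w.2 w'.1 :=
      continuous_of_discreteTopology.comp continuous_fst
    change Continuous (Ω w)
    rw [funext (hΩ w)]
    exact h_eval.sub h_fst
  · obtain ⟨v, hv⟩ := exists_eq_dual_eval_of_continuous (φ ∘ₗ LinearMap.inr K V (Module.Dual K V))
      (Continuous.comp (g := φ) hφ (Continuous.prodMk_right (0 : V)))
    refine ⟨(v, -(φ ∘ₗ LinearMap.inl K V (Module.Dual K V))), funext fun x => ?_, fun w hw => ?_⟩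
    · have h_split : φ x = φ (0, x.2) + φ (x.1, 0) := by
        rw [← map_add]
        simp
      have h_eval : x.2 v = φ (0, x.2) := LinearMap.congr_fun hv x.2
      simp [hΩ, h_split, h_eval]
    · refine Prod.ext ?_ (LinearMap.ext fun x => ?_)
      · refine Module.eval_apply_injective K (LinearMap.ext fun f => ?_)
        rw [hv]
        simp [hw, hΩ]
      · simp [hw, hΩ]
end

section
/- Triviality of the residue-constraint locus in the Tate space W_Airy: Let x : ℤ_{>0} → ℂ be arbitrary and let y : ℤ_{>0} → ℂ have finite support. Define J : ℤ → ℂ by J(k) = y(k) and J(−k) = k·x(k) for k ≥ 1, and J(0) = 0. Suppose that for every n ≥ 1 one has y(2n) = 0 and y(2n−1) = (1/4)·Σ_{m ∈ ℤ} J(m)·J(2n−4−m), where the family (J(m)·J(2n−4−m))_{m∈ℤ} has finite support so that the sum may be taken as a finite sum (finsum). Then x(1) = 0 and y(k) = 0 for every k ≥ 1. -/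
/-- If `J` vanishes above `N`, the only surviving term of the convolution of `J` with itself in
degree `2 * N` is the diagonal one. -/
lemma finsum_mul_two_mul_sub_eq_sq {R : Type*} [Semiring R] {J : ℤ → R} {N : ℤ}
    (h : ∀ a, N < a → J a = 0) : ∑ᶠ m : ℤ, J m * J (2 * N - m) = J N ^ 2 := by
  rw [finsum_eq_single _ N, sq, show 2 * N - N = N by ring]
  intro m hm
  rcases lt_or_gt_of_ne hm with hlt | hgt
  · rw [h (2 * N - m) (by omega), mul_zero]
  · rw [h m hgt, zero_mul]


/-- **Triviality of the residue-constraint locus in the Tate space `W_Airy`.**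
Let `x, y : ℤ_{>0} → ℂ` with `y` finitely supported, and `J : ℤ → ℂ` given by
`J k = y k`, `J (−k) = k · x k` for `k ≥ 1` and `J 0 = 0`.  If for every `n ≥ 1` one has
`y (2n) = 0` and `y (2n−1) = (1/4) Σᶠ_{m ∈ ℤ} J m · J (2n−4−m)` (the family having finite
support), then `x 1 = 0` and `y k = 0` for all `k ≥ 1`. -/
theorem residue_constraints_trivial_in_tate_space
    (x y : ℕ+ → ℂ) (hy : (Function.support y).Finite)
    (J : ℤ → ℂ)
    (hJpos : ∀ k : ℕ+, J ((k : ℕ) : ℤ) = y k)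
    (hJneg : ∀ k : ℕ+, J (-((k : ℕ) : ℤ)) = ((k : ℕ) : ℂ) * x k)
    (hJ0 : J 0 = 0)
    (heven : ∀ n : ℕ+, y (2 * n) = 0)
    (hfin : ∀ n : ℕ+,
      (Function.support fun m : ℤ => J m * J (2 * ((n : ℕ) : ℤ) - 4 - m)).Finite)
    (hodd : ∀ n : ℕ+,
      y (2 * n - 1) = (1 / 4) * ∑ᶠ m : ℤ, J m * J (2 * ((n : ℕ) : ℤ) - 4 - m)) :
    x 1 = 0 ∧ ∀ k : ℕ+, y k = 0 := by
  have hJ_of_lt : ∀ a : ℤ, 0 < a → (∀ k : ℕ+, (k : ℤ) = a → y k = 0) → J a = 0 := by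
    intro a ha h
    lift a to ℕ using ha.le
    have := hJpos ⟨a, by omega⟩
    rwa [h ⟨a, by omega⟩ rfl] at this
  have hy0 : ∀ k : ℕ+, y k = 0 := by
    by_contra! hne
    obtain ⟨N, hN, hmax⟩ := Set.exists_max_image _ id hy hne
    have hvan : ∀ k : ℕ+, N < k → y k = 0 := fun k hk => by
      by_contra hk0
      exact absurd (hmax k hk0) (not_le.mpr hk)
    have hsum := hodd (N + 2)
    have hlt : N < 2 * (N + 2) - 1 := by
      rw [← PNat.coe_lt_coe, PNat.sub_coe, if_pos]
      · push_cast
        omega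
      · rw [← PNat.coe_lt_coe]
        push_cast
        omega
    have hdeg : (2 * (((N + 2 : ℕ+) : ℕ) : ℤ) - 4) = 2 * (N : ℤ) := by
      push_cast
      ring
    rw [hvan _ hlt, hdeg, finsum_mul_two_mul_sub_eq_sq, hJpos] at hsum
    · exact hN (by simpa using hsum)
    · intro a ha
      have hN0 := N.pos
      refine hJ_of_lt a (by omega) fun k hk => hvan k ?_
      rw [← PNat.coe_lt_coe]
      omega
  refine ⟨?_, hy0⟩
  have hsum := hodd 1
  have hdeg : (2 * (((1 : ℕ+) : ℕ) : ℤ) - 4) = 2 * (-1) := by norm_num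
  rw [hy0, hdeg, finsum_mul_two_mul_sub_eq_sq] at hsum
  · have hx := hJneg 1
    simp only [PNat.one_coe, Nat.cast_one, one_mul] at hx
    rw [hx] at hsum
    simpa using hsum
  · intro a ha
    rcases eq_or_ne a 0 with rfl | ha0
    · exact hJ0
    · exact hJ_of_lt a (by omega) fun k _ => hy0 k
end
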